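/- Let G be a (P5,dart)-free finite simple graph containing an induced 5-cycle C with vertices v1,...,v5, and let S3^1, S4, S5 be defined with respect to C as in the context. If u, u' ∈ S5 are nonadjacent, then every vertex in S3^1 ∪ S4 is adjacent to at least one of u and u'. -/

import Mathlib

open SimpleGraph

/-- `G` contains an induced subgraph isomorphic to `H`. -/
def ContainsInduced {V : Type*} {W : Type*} (G : SimpleGraph V) (H : SimpleGraph W) : Prop :=
  ∃ f : W ↪ V, ∀ a b, H.Adj a b ↔ G.Adj (f a) (f b)

/-- The path on 5 vertices. -/
def P5 : SimpleGraph (Fin 5) := SimpleGraph.pathGraph 5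

/-- The dart: vertices `0,1,2,3,4` and edges `01, 12, 23, 30, 02, 24`. -/
def dart : SimpleGraph (Fin 5) :=
  SimpleGraph.fromRel (fun a b =>
    (a, b) = (0, 1) ∨ (a, b) = (1, 2) ∨ (a, b) = (2, 3) ∨
    (a, b) = (3, 0) ∨ (a, b) = (0, 2) ∨ (a, b) = (2, 4))

/-- `G` is `k`-vertex-critical: `χ(G) = k` and `χ(G - v) < k` for every vertex `v`. -/
def IsVertexCritical {V : Type*} (G : SimpleGraph V) (k : ℕ) : Prop :=
  G.chromaticNumber = k ∧
  ∀ v : V, (G.induce {u | u ≠ v}).chromaticNumber < k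

/-- The cycle on 5 vertices (indices in `Fin 5`, `i` adjacent to `i + 1`). -/
def C5 : SimpleGraph (Fin 5) := SimpleGraph.fromRel (fun a b => b = a + 1)

/-- `S0`: the vertices off the 5-cycle `v` with no neighbour on it. -/
def S0 {V : Type*} (G : SimpleGraph V) (v : Fin 5 → V) : Set V :=
  {u | u ∉ Set.range v ∧ ∀ j, ¬ G.Adj u (v j)}

/-- `S2(i)`: vertices off the 5-cycle `v` whose neighbourhood on it is exactly
`{v (i-1), v (i+1)}`. -/
def S2 {V : Type*} (G : SimpleGraph V) (v : Fin 5 → V) (i : Fin 5) : Set V :=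
  {u | u ∉ Set.range v ∧ ∀ j, G.Adj u (v j) ↔ (j = i - 1 ∨ j = i + 1)}

/-- `S3^1(i)`: vertices off the 5-cycle `v` whose neighbourhood on it is exactly
`{v (i-1), v i, v (i+1)}`. -/
def S31 {V : Type*} (G : SimpleGraph V) (v : Fin 5 → V) (i : Fin 5) : Set V :=
  {u | u ∉ Set.range v ∧ ∀ j, G.Adj u (v j) ↔ (j = i - 1 ∨ j = i ∨ j = i + 1)}

/-- `S3^2(i)`: vertices off the 5-cycle `v` whose neighbourhood on it is exactly
`{v (i-2), v i, v (i+2)}`. -/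
def S32 {V : Type*} (G : SimpleGraph V) (v : Fin 5 → V) (i : Fin 5) : Set V :=
  {u | u ∉ Set.range v ∧ ∀ j, G.Adj u (v j) ↔ (j = i - 2 ∨ j = i ∨ j = i + 2)}

/-- `S4(i)`: vertices off the 5-cycle `v` whose neighbourhood on it is exactly
`{v (i-2), v (i-1), v (i+1), v (i+2)}`. -/
def S4 {V : Type*} (G : SimpleGraph V) (v : Fin 5 → V) (i : Fin 5) : Set V :=
  {u | u ∉ Set.range v ∧
    ∀ j, G.Adj u (v j) ↔ (j = i - 2 ∨ j = i - 1 ∨ j = i + 1 ∨ j = i + 2)}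

/-- `S5`: vertices off the 5-cycle `v` adjacent to all five of its vertices. -/
def S5 {V : Type*} (G : SimpleGraph V) (v : Fin 5 → V) : Set V :=
  {u | u ∉ Set.range v ∧ ∀ j, G.Adj u (v j)}

/-- A diamond with nonadjacent vertices `b`, `d` together with a vertex `e` adjacent only to the
degree-three vertex `c` of the diamond is an induced dart. -/
theorem containsInduced_dart {V : Type*} {G : SimpleGraph V} {a b c d e : V}
    (hab : G.Adj a b) (hbc : G.Adj b c) (hcd : G.Adj c d) (hda : G.Adj d a)
    (hac : G.Adj a c) (hce : G.Adj c e) (hbd : b ≠ d) (nbd : ¬ G.Adj b d)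
    (nae : ¬ G.Adj a e) (nbe : ¬ G.Adj b e) (nde : ¬ G.Adj d e) :
    ContainsInduced G dart := by
  have hae : a ≠ e := by rintro rfl; exact nbe hab.symm
  have hbe : b ≠ e := by rintro rfl; exact nae hab
  have hde : d ≠ e := by rintro rfl; exact nae hda.symm
  refine ⟨⟨![a, b, c, d, e], ?_⟩, ?_⟩
  · intro x y hxy
    fin_cases x <;> fin_cases y <;>
      simp_all [hab.ne, hab.ne', hbc.ne, hbc.ne', hcd.ne, hcd.ne', hda.ne, hda.ne',
        hac.ne, hac.ne', hce.ne, hce.ne', hbd.symm, hae.symm, hbe.symm, hde.symm]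
  · intro x y
    change dart.Adj x y ↔ G.Adj (![a, b, c, d, e] x) (![a, b, c, d, e] y)
    fin_cases x <;> fin_cases y <;> simp_all [dart, G.adj_comm]

/-- If `u`, `u'` are nonadjacent common neighbours of an adjacent pair `x`, `y` in a dart-free
graph, then a vertex adjacent to `x` but not to `y` is adjacent to `u` or `u'`. -/
theorem adj_or_adj_of_dart_free {V : Type*} {G : SimpleGraph V}
    (hdart : ¬ ContainsInduced G dart) {u u' x y w : V} (hne : u ≠ u') (huu' : ¬ G.Adj u u')
    (hux : G.Adj u x) (huy : G.Adj u y) (hux' : G.Adj u' x) (huy' : G.Adj u' y)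
    (hxy : G.Adj x y) (hwx : G.Adj w x) (hwy : ¬ G.Adj w y) :
    G.Adj w u ∨ G.Adj w u' := by
  by_contra! h
  exact hdart (containsInduced_dart huy.symm hux hux'.symm huy' hxy.symm hwx.symm hne huu'
    (fun k => hwy k.symm) (fun k => h.1 k.symm) (fun k => h.2 k.symm))

theorem S5_nonadjacent_pair_dominates_S31_S4 {V : Type} [Fintype V] (G : SimpleGraph V)
    (hP5 : ¬ ContainsInduced G P5) (hdart : ¬ ContainsInduced G dart)
    (v : Fin 5 → V) (hinj : Function.Injective v)
    (hC : ∀ i j, G.Adj (v i) (v j) ↔ C5.Adj i j) :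
    ∀ u ∈ S5 G v, ∀ u' ∈ S5 G v, u ≠ u' → ¬ G.Adj u u' →
      ∀ w ∈ (⋃ i, S31 G v i) ∪ (⋃ i, S4 G v i), G.Adj w u ∨ G.Adj w u' := by
  rintro u ⟨-, hu⟩ u' ⟨-, hu'⟩ hne huu' w hw
  obtain ⟨j, hj, hj'⟩ : ∃ j, G.Adj w (v j) ∧ ¬ G.Adj w (v (j + 1)) := by
    simp only [Set.mem_union, Set.mem_iUnion] at hw
    obtain ⟨i, -, hw⟩ | ⟨i, -, hw⟩ := hw
    · refine ⟨i + 1, ?_, ?_⟩ <;> rw [hw] <;> fin_cases i <;> decide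
    · refine ⟨i - 1, ?_, ?_⟩ <;> rw [hw] <;> fin_cases i <;> decide
  have hadj : G.Adj (v j) (v (j + 1)) := by
    rw [hC]
    simp [C5]
  exact adj_or_adj_of_dart_free hdart hne huu' (hu _) (hu _) (hu' _) (hu' _) hadj hj hj'
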